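/- arXiv:1703.10281 — 4 statements merged into one kernel-verified Lean document; each statement's English description precedes it below -/
import Mathlib

section
/- Let A ∈ ℝ^{n×n}, B ∈ ℝ^{n×m}, C ∈ ℝ^{m×n}, D ∈ ℝ^{m×m} with D = Dᵀ, and define M(s) = C(sI−A)⁻¹B + D for s ∈ ℂ not an eigenvalue of A. Suppose there exists a real symmetric matrix P = Pᵀ ≥ 0 such that the block matrix [[PA + AᵀP, PB − AᵀCᵀ],[BᵀP − CA, −(CB + BᵀCᵀ)]] is negative semidefinite. Then for every ω > 0 such that iω is not an eigenvalue of A, the Hermitian matrix i(M(iω) − M(iω)†) is positive semidefinite. -/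
open Matrix Filter Topology
open scoped ComplexOrder

/-- Complexification of a real matrix. -/
noncomputable def cmat {k l : Type*} (M : Matrix k l ℝ) : Matrix k l ℂ :=
  M.map Complex.ofReal

/-- The transfer function `M(s) = C (sI - A)⁻¹ B + D` of a real state-space realization. -/
noncomputable def transferFun {n m : ℕ} (A : Matrix (Fin n) (Fin n) ℝ)
    (B : Matrix (Fin n) (Fin m) ℝ) (C : Matrix (Fin m) (Fin n) ℝ)
    (D : Matrix (Fin m) (Fin m) ℝ) (s : ℂ) : Matrix (Fin m) (Fin m) ℂ :=
  cmat C * (s • (1 : Matrix (Fin n) (Fin n) ℂ) - cmat A)⁻¹ * cmat B + cmat D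

/-- The complexification of a real positive semidefinite matrix is positive semidefinite. -/
theorem Matrix.PosSemidef.cmat {k : Type*} [Fintype k] {Q : Matrix k k ℝ}
    (hQ : Q.PosSemidef) : (_root_.cmat Q).PosSemidef := by
  classical
  obtain ⟨R, rfl⟩ : ∃ R : Matrix k k ℝ, Q = Rᴴ * R := by
    open scoped MatrixOrder in
    exact CStarAlgebra.nonneg_iff_eq_star_mul_self.mp hQ.nonneg
  have h : _root_.cmat (Rᴴ * R) = (_root_.cmat R)ᴴ * _root_.cmat R := by
    ext i j
    simp [_root_.cmat, Matrix.mul_apply]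
  rw [h]
  exact Matrix.posSemidef_conjTranspose_mul_self _

theorem cmat_mul {k l r : Type*} [Fintype l] (M : Matrix k l ℝ) (N : Matrix l r ℝ) :
    cmat (M * N) = cmat M * cmat N := by
  ext i j
  simp [cmat, Matrix.mul_apply]

theorem cmat_transpose {k l : Type*} (M : Matrix k l ℝ) : cmat Mᵀ = (cmat M)ᴴ := by
  ext i j
  simp [cmat]

theorem cmat_add {k l : Type*} (M N : Matrix k l ℝ) : cmat (M + N) = cmat M + cmat N := by
  ext i j
  simp [cmat]

theorem cmat_sub {k l : Type*} (M N : Matrix k l ℝ) : cmat (M - N) = cmat M - cmat N := by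
  ext i j
  simp [cmat]

theorem cmat_neg {k l : Type*} (M : Matrix k l ℝ) : cmat (-M) = -cmat M := by
  ext i j
  simp [cmat]

theorem cmat_fromBlocks {k l r s : Type*} (M : Matrix k r ℝ) (N : Matrix k s ℝ)
    (U : Matrix l r ℝ) (V : Matrix l s ℝ) :
    cmat (Matrix.fromBlocks M N U V) =
      Matrix.fromBlocks (cmat M) (cmat N) (cmat U) (cmat V) :=
  Matrix.fromBlocks_map M N U V _

/-- Compressing the negative imaginary block matrix along `[X; 1]`, where `A X + B = z X` with
`z` purely imaginary. -/
theorem negImaginary_compression {k l : Type*} [Fintype k] [Fintype l] [DecidableEq l]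
    {A P : Matrix k k ℂ} {B X : Matrix k l ℂ} {C : Matrix l k ℂ} {z : ℂ}
    (hz : star z = -z) (hX : A * X + B = z • X) :
    (Matrix.fromRows X (1 : Matrix l l ℂ))ᴴ *
      (-(Matrix.fromBlocks (P * A + Aᴴ * P) (P * B - Aᴴ * Cᴴ)
        (Bᴴ * P - C * A) (-(C * B + Bᴴ * Cᴴ)))) * Matrix.fromRows X (1 : Matrix l l ℂ) =
      z • (C * X - (C * X)ᴴ) := by
  have hX' : Xᴴ * Aᴴ + Bᴴ = -(z • Xᴴ) := by
    have h := congrArg Matrix.conjTranspose hX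
    rwa [conjTranspose_add, conjTranspose_mul, conjTranspose_smul, hz, neg_smul] at h
  have hB : B = z • X - A * X := by rw [← hX]; abel
  have hB' : Bᴴ = -(z • Xᴴ) - Xᴴ * Aᴴ := by rw [← hX']; abel
  rw [hB', hB, Matrix.mul_assoc, Matrix.neg_mul, Matrix.fromBlocks_mul_fromRows,
    Matrix.conjTranspose_fromRows_eq_fromCols_conjTranspose, Matrix.mul_neg,
    Matrix.fromCols_mul_fromRows]
  simp only [Matrix.conjTranspose_one, Matrix.one_mul, Matrix.mul_one, Matrix.mul_add,
    Matrix.add_mul, Matrix.mul_sub, Matrix.sub_mul, Matrix.neg_mul, Matrix.mul_neg,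
    Matrix.smul_mul, Matrix.mul_smul, Matrix.conjTranspose_mul, Matrix.mul_assoc, smul_sub]
  abel

/-- If `D = Dᵀ` and there is a real symmetric positive semidefinite `P` making the
negative imaginary LMI hold, then `i (M(iω) - M(iω)†) ≥ 0` for all `ω > 0` such that
`iω` is not an eigenvalue of `A`. -/
theorem stmt_1 {n m : ℕ} (A : Matrix (Fin n) (Fin n) ℝ) (B : Matrix (Fin n) (Fin m) ℝ)
    (C : Matrix (Fin m) (Fin n) ℝ) (D : Matrix (Fin m) (Fin m) ℝ)
    (hD : D = Dᵀ)
    (P : Matrix (Fin n) (Fin n) ℝ) (hPsymm : P = Pᵀ) (hPpsd : P.PosSemidef)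
    (hLMI : (-(Matrix.fromBlocks (P * A + Aᵀ * P) (P * B - Aᵀ * Cᵀ)
        (Bᵀ * P - C * A) (-(C * B + Bᵀ * Cᵀ)))).PosSemidef) :
    ∀ ω : ℝ, 0 < ω → (Complex.I * (ω : ℂ)) ∉ spectrum ℂ (cmat A) →
      (Complex.I • (transferFun A B C D (Complex.I * (ω : ℂ)) -
        (transferFun A B C D (Complex.I * (ω : ℂ)))ᴴ)).PosSemidef := by
  intro ω hω hs
  set z : ℂ := Complex.I * (ω : ℂ) with hz_def
  have hz : star z = -z := by simp [hz_def]
  set G : Matrix (Fin n) (Fin n) ℂ := z • (1 : Matrix (Fin n) (Fin n) ℂ) - cmat A with hG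
  have hunit : IsUnit G := by
    rwa [spectrum.notMem_iff, Algebra.algebraMap_eq_smul_one] at hs
  have hX : cmat A * (G⁻¹ * cmat B) + cmat B = z • (G⁻¹ * cmat B) := by
    have h : G * (G⁻¹ * cmat B) = cmat B := by
      rw [← Matrix.mul_assoc, Matrix.mul_nonsing_inv _ ((Matrix.isUnit_iff_isUnit_det _).mp hunit),
        Matrix.one_mul]
    have h' : G * (G⁻¹ * cmat B) = z • (G⁻¹ * cmat B) - cmat A * (G⁻¹ * cmat B) := by
      conv_lhs => rw [hG, Matrix.sub_mul, Matrix.smul_mul, Matrix.one_mul]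
    rw [h] at h'
    exact (add_comm _ _).trans (eq_sub_iff_add_eq.mp h')
  have hQ := hLMI.cmat
  simp only [cmat_neg, cmat_fromBlocks, cmat_add, cmat_sub, cmat_mul, cmat_transpose] at hQ
  have hC := hQ.conjTranspose_mul_mul_same
    (Matrix.fromRows (G⁻¹ * cmat B) (1 : Matrix (Fin m) (Fin m) ℂ))
  rw [negImaginary_compression hz hX] at hC
  have hDc : (cmat D)ᴴ = cmat D := by rw [← cmat_transpose, ← hD]
  have hM : Complex.I • (transferFun A B C D z - (transferFun A B C D z)ᴴ) =
      ((ω⁻¹ : ℝ) : ℂ) • (z • (cmat C * (G⁻¹ * cmat B) - (cmat C * (G⁻¹ * cmat B))ᴴ)) := by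
    have hω' : (ω : ℂ) ≠ 0 := by exact_mod_cast hω.ne'
    have hscal : ((ω⁻¹ : ℝ) : ℂ) * z = Complex.I := by
      rw [hz_def]
      push_cast
      field_simp
    rw [smul_smul, hscal, transferFun, ← hG, conjTranspose_add, hDc, Matrix.mul_assoc,
      add_sub_add_right_eq_sub]
  rw [hM]
  exact hC.smul (by exact_mod_cast (inv_pos.mpr hω).le)
end

section
/- Let A ∈ ℝ^{n×n}, B ∈ ℝ^{n×m}, C ∈ ℝ^{m×n} be real matrices such that R := CB + BᵀCᵀ is positive definite, and let P = Pᵀ be a real symmetric matrix satisfying the algebraic Riccati equation PA₀ + A₀ᵀP + P B R⁻¹ Bᵀ P + Q = 0, where A₀ = A − B R⁻¹ C A and Q = Aᵀ Cᵀ R⁻¹ C A. Then the block matrix [[PA + AᵀP, PB − AᵀCᵀ],[BᵀP − CA, −R]] is negative semidefinite. -/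
open Matrix

/-- If `R := CB + BᵀCᵀ > 0` and the symmetric matrix `P` satisfies the NI algebraic Riccati
equation `P A₀ + A₀ᵀ P + P B R⁻¹ Bᵀ P + Q = 0` with `A₀ = A - B R⁻¹ C A` and
`Q = Aᵀ Cᵀ R⁻¹ C A`, then the NI LMI block matrix is negative semidefinite. -/
theorem stmt_3 {n m : ℕ} (A : Matrix (Fin n) (Fin n) ℝ) (B : Matrix (Fin n) (Fin m) ℝ)
    (C : Matrix (Fin m) (Fin n) ℝ)
    (R : Matrix (Fin m) (Fin m) ℝ) (hR : R = C * B + Bᵀ * Cᵀ) (hRpd : R.PosDef)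
    (A₀ : Matrix (Fin n) (Fin n) ℝ) (hA₀ : A₀ = A - B * R⁻¹ * (C * A))
    (Q : Matrix (Fin n) (Fin n) ℝ) (hQ : Q = Aᵀ * Cᵀ * R⁻¹ * (C * A))
    (P : Matrix (Fin n) (Fin n) ℝ) (hPsymm : P = Pᵀ)
    (hRic : P * A₀ + A₀ᵀ * P + P * B * R⁻¹ * Bᵀ * P + Q = 0) :
    (-(Matrix.fromBlocks (P * A + Aᵀ * P) (P * B - Aᵀ * Cᵀ)
      (Bᵀ * P - C * A) (-R))).PosSemidef := by
  have hRiT : R⁻¹ᵀ = R⁻¹ := by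
    have hRT : Rᵀ = R := by simpa using hRpd.isHermitian.eq
    rw [transpose_nonsing_inv, hRT]
  have : Invertible R := hRpd.isUnit.invertible
  have hBlock : -(fromBlocks (P * A + Aᵀ * P) (P * B - Aᵀ * Cᵀ) (Bᵀ * P - C * A) (-R)) =
      fromBlocks (-(P * A + Aᵀ * P)) (Aᵀ * Cᵀ - P * B) (Aᵀ * Cᵀ - P * B)ᴴ R := by
    rw [fromBlocks_neg]
    simp [conjTranspose_eq_transpose_of_trivial, ← hPsymm]
  have hSchur : -(P * A + Aᵀ * P) -
      (Aᵀ * Cᵀ - P * B) * R⁻¹ * (Aᵀ * Cᵀ - P * B)ᴴ = 0 := by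
    rw [← neg_eq_zero, ← hRic, hA₀, hQ]
    simp only [conjTranspose_eq_transpose_of_trivial, transpose_sub, transpose_mul,
      transpose_transpose, ← hPsymm, hRiT]
    simp only [Matrix.mul_sub, Matrix.sub_mul, Matrix.mul_assoc]
    abel
  rw [hBlock, hRpd.fromBlocks₂₂, hSchur]
  exact PosSemidef.zero
end

section
/- Consider real matrices A ∈ ℝ^{n×n}, B₁ ∈ ℝ^{n×m}, B₂ ∈ ℝ^{n×r}, C₁ ∈ ℝ^{m×n} with C₁B₂ nonsingular and R := C₁B₁ + B₁ᵀC₁ᵀ positive definite. Let U be a real orthogonal matrix such that A_f := Uᵀ(A − B₂(C₁B₂)⁻¹C₁A)U = [[A₁₁, A₁₂],[0, A₂₂]] is block upper triangular with A₂₂ anti-stable (all eigenvalues of A₂₂ have positive real part), and partition B_f := Uᵀ(B₂(C₁B₂)⁻¹ − B₁R⁻¹) = [B_{f1}; B_{f2}] and B̃₁ := UᵀB₁ = [B₁₁; B₂₂] conformably. Suppose there exist real symmetric matrices T ≥ 0 and S ≥ 0 satisfying −A₂₂T − TA₂₂ᵀ + B_{f2} R B_{f2}ᵀ = 0 and −A₂₂S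 − SA₂₂ᵀ + B₂₂ R⁻¹ B₂₂ᵀ = 0, with T − S positive definite. Define P := U P_f Uᵀ where P_f = [[0,0],[0,(T−S)⁻¹]], and the state-feedback gain K := (C₁B₂)⁻¹(B₁ᵀP − C₁A − R(B₂ᵀC₁ᵀ)⁻¹B₂ᵀP). Then P is symmetric positive semidefinite and, with Ā := A + B₂K, P satisfies the closed-loop negative imaginary algebraic Riccati equation P Ā₀ + Ā₀ᵀ P + P B₁ R⁻¹ B₁ᵀ P + Āᵀ C₁ᵀ R⁻¹ C₁ Ā = 0, where Ā₀ = Ā − B₁ R⁻¹ C₁ Ā. -/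
open Matrix

/-- A real square matrix is anti-stable if all of its eigenvalues have positive real part. -/
noncomputable def IsAntiStable {k : Type*} [Fintype k] [DecidableEq k]
    (M : Matrix k k ℝ) : Prop :=
  ∀ z ∈ spectrum ℂ (cmat M), 0 < z.re

/-- If `Y` is symmetric, invertible and solves the Lyapunov equation `A Y + Y Aᵀ = Q`, then `Y⁻¹`
solves the Riccati equation `Y⁻¹ A + Aᵀ Y⁻¹ = Y⁻¹ Q Y⁻¹`. -/
theorem riccati_inv_of_lyapunov {k : Type*} [Fintype k] [DecidableEq k]
    {A Y Q : Matrix k k ℝ} (hY : IsUnit Y) (h : A * Y + Y * Aᵀ = Q) :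
    Y⁻¹ * A + Aᵀ * Y⁻¹ = Y⁻¹ * Q * Y⁻¹ := by
  have hdet := (Matrix.isUnit_iff_isUnit_det Y).mp hY
  rw [← h, Matrix.mul_add, Matrix.add_mul, ← Matrix.mul_assoc, ← Matrix.mul_assoc,
    Matrix.mul_nonsing_inv_cancel_right _ _ hdet, Matrix.nonsing_inv_mul _ hdet, Matrix.one_mul]

/-- Closed-loop form of the negative imaginary Riccati expression: with `F = A - G C A`,
`C G = 1` and `B = G - B₁ R⁻¹`, the closed-loop matrix is `F - G R Bᵀ P`. -/
theorem closedLoop_riccati {k l : Type*} [Fintype k] [Fintype l]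
    [DecidableEq l] {F P : Matrix k k ℝ} {B B₁ G : Matrix k l ℝ} {C : Matrix l k ℝ}
    {R : Matrix l l ℝ} (hR : IsUnit R) (hRt : Rᵀ = R) (hPt : Pᵀ = P)
    (hCF : C * F = 0) (hCG : C * G = 1) (hB : B * R = G * R - B₁)
    (hF : P * F + Fᵀ * P = P * (B * R * Bᵀ - B₁ * R⁻¹ * B₁ᵀ) * P)
    {Abar Abar₀ : Matrix k k ℝ} (hAbar : Abar = F - G * R * Bᵀ * P)
    (hAbar₀ : Abar₀ = Abar - B₁ * R⁻¹ * (C * Abar)) :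
    P * Abar₀ + Abar₀ᵀ * P + P * B₁ * R⁻¹ * B₁ᵀ * P + Abarᵀ * Cᵀ * R⁻¹ * (C * Abar) = 0 := by
  have hdet := (Matrix.isUnit_iff_isUnit_det R).mp hR
  have hC : C * Abar = -(R * Bᵀ * P) := by
    rw [hAbar, Matrix.mul_sub, hCF, zero_sub]
    simp only [← Matrix.mul_assoc, hCG, Matrix.one_mul]
  have h₀ : Abar₀ = F - B * R * Bᵀ * P := by
    rw [hAbar₀, hC, hAbar, hB]
    have : B₁ * R⁻¹ * -(R * Bᵀ * P) = -(B₁ * Bᵀ * P) := by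
      simp only [Matrix.mul_neg, ← Matrix.mul_assoc,
        Matrix.nonsing_inv_mul_cancel_right _ _ hdet]
    rw [this]
    simp only [Matrix.sub_mul]
    abel
  have hquad : Abarᵀ * Cᵀ * R⁻¹ * (C * Abar) = P * (B * R * Bᵀ) * P := by
    rw [← Matrix.transpose_mul, hC]
    simp only [Matrix.transpose_neg, Matrix.transpose_mul, Matrix.transpose_transpose, hRt, hPt,
      Matrix.neg_mul, Matrix.mul_neg, neg_neg, ← Matrix.mul_assoc,
      Matrix.nonsing_inv_mul_cancel_right _ _ hdet]
  have hF' : P * F = P * (B * R * Bᵀ - B₁ * R⁻¹ * B₁ᵀ) * P - Fᵀ * P := by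
    rw [← hF, add_sub_cancel_right]
  rw [hquad, h₀]
  simp only [Matrix.transpose_sub, Matrix.transpose_mul, Matrix.transpose_transpose, hRt, hPt,
    Matrix.mul_sub, Matrix.sub_mul, hF', Matrix.mul_assoc]
  abel

/-- State feedback NI synthesis (Theorem 5 of the paper): under the stated Schur transformation
and Lyapunov-equation conditions, the matrix `P = U P_f Uᵀ` is symmetric positive semidefinite
and satisfies the closed-loop negative imaginary algebraic Riccati equation for `Ā = A + B₂ K`
with the stated state-feedback gain `K`. -/
theorem stmt_5 {n₁ n₂ m : ℕ}
    (A : Matrix (Fin n₁ ⊕ Fin n₂) (Fin n₁ ⊕ Fin n₂) ℝ)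
    (B₁ B₂ : Matrix (Fin n₁ ⊕ Fin n₂) (Fin m) ℝ)
    (C₁ : Matrix (Fin m) (Fin n₁ ⊕ Fin n₂) ℝ)
    (hC₁B₂ : IsUnit (C₁ * B₂))
    (R : Matrix (Fin m) (Fin m) ℝ) (hR : R = C₁ * B₁ + B₁ᵀ * C₁ᵀ) (hRpd : R.PosDef)
    (U : Matrix (Fin n₁ ⊕ Fin n₂) (Fin n₁ ⊕ Fin n₂) ℝ) (hU : Uᵀ * U = 1)
    (A₁₁ : Matrix (Fin n₁) (Fin n₁) ℝ) (A₁₂ : Matrix (Fin n₁) (Fin n₂) ℝ)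
    (A₂₂ : Matrix (Fin n₂) (Fin n₂) ℝ)
    (hAf : Uᵀ * (A - B₂ * (C₁ * B₂)⁻¹ * (C₁ * A)) * U = Matrix.fromBlocks A₁₁ A₁₂ 0 A₂₂)
    (hA₂₂ : IsAntiStable A₂₂)
    (Bf1 : Matrix (Fin n₁) (Fin m) ℝ) (Bf2 : Matrix (Fin n₂) (Fin m) ℝ)
    (hBf : Uᵀ * (B₂ * (C₁ * B₂)⁻¹ - B₁ * R⁻¹) = Matrix.fromRows Bf1 Bf2)
    (B₁₁ : Matrix (Fin n₁) (Fin m) ℝ) (B₂₂ : Matrix (Fin n₂) (Fin m) ℝ)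
    (hB1 : Uᵀ * B₁ = Matrix.fromRows B₁₁ B₂₂)
    (T S : Matrix (Fin n₂) (Fin n₂) ℝ) (hT : T.PosSemidef) (hS : S.PosSemidef)
    (hLyapT : -(A₂₂ * T) - T * A₂₂ᵀ + Bf2 * R * Bf2ᵀ = 0)
    (hLyapS : -(A₂₂ * S) - S * A₂₂ᵀ + B₂₂ * R⁻¹ * B₂₂ᵀ = 0)
    (hTS : (T - S).PosDef)
    (P : Matrix (Fin n₁ ⊕ Fin n₂) (Fin n₁ ⊕ Fin n₂) ℝ)
    (hP : P = U * Matrix.fromBlocks 0 0 0 (T - S)⁻¹ * Uᵀ)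
    (K : Matrix (Fin m) (Fin n₁ ⊕ Fin n₂) ℝ)
    (hK : K = (C₁ * B₂)⁻¹ * (B₁ᵀ * P - C₁ * A - R * (B₂ᵀ * C₁ᵀ)⁻¹ * (B₂ᵀ * P)))
    (Abar : Matrix (Fin n₁ ⊕ Fin n₂) (Fin n₁ ⊕ Fin n₂) ℝ) (hAbar : Abar = A + B₂ * K)
    (Abar₀ : Matrix (Fin n₁ ⊕ Fin n₂) (Fin n₁ ⊕ Fin n₂) ℝ)
    (hAbar₀ : Abar₀ = Abar - B₁ * R⁻¹ * (C₁ * Abar)) :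
    P.PosSemidef ∧
      P * Abar₀ + Abar₀ᵀ * P + P * B₁ * R⁻¹ * B₁ᵀ * P + Abarᵀ * C₁ᵀ * R⁻¹ * (C₁ * Abar) = 0 := by
  have hRu : IsUnit R := hRpd.isUnit
  have hRdet := (Matrix.isUnit_iff_isUnit_det R).mp hRu
  have hNdet := (Matrix.isUnit_iff_isUnit_det (C₁ * B₂)).mp hC₁B₂
  have hRt : Rᵀ = R := by simpa using hRpd.isHermitian.eq
  have hUU : U * Uᵀ = 1 := mul_eq_one_comm.mp hU
  have hPpsd : P.PosSemidef := by
    have hX : (fromBlocks 0 0 0 (T - S)⁻¹ :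
        Matrix (Fin n₁ ⊕ Fin n₂) (Fin n₁ ⊕ Fin n₂) ℝ).PosSemidef := by
      have h := hTS.inv.posSemidef.conjTranspose_mul_mul_same
        (fromCols (0 : Matrix (Fin n₂) (Fin n₁) ℝ) (1 : Matrix (Fin n₂) (Fin n₂) ℝ))
      rw [conjTranspose_fromCols_eq_fromRows_conjTranspose, fromRows_mul,
        fromRows_mul_fromCols] at h
      simpa using h
    rw [hP]
    simpa using hX.mul_mul_conjTranspose_same U
  have hPt : Pᵀ = P := by simpa using hPpsd.isHermitian.eq
  refine ⟨hPpsd, ?_⟩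
  have hLyap : A₂₂ * (T - S) + (T - S) * A₂₂ᵀ = Bf2 * R * Bf2ᵀ - B₂₂ * R⁻¹ * B₂₂ᵀ := by
    have h : Bf2 * R * Bf2ᵀ = A₂₂ * T + T * A₂₂ᵀ := by
      rw [← sub_eq_zero, ← hLyapT]; abel
    have h' : B₂₂ * R⁻¹ * B₂₂ᵀ = A₂₂ * S + S * A₂₂ᵀ := by
      rw [← sub_eq_zero, ← hLyapS]; abel
    rw [h, h', Matrix.mul_sub, Matrix.sub_mul]
    abel
  have hX := riccati_inv_of_lyapunov hTS.isUnit hLyap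
  set G := B₂ * (C₁ * B₂)⁻¹ with hG
  set F := A - G * (C₁ * A) with hFdef
  have hCG : C₁ * G = 1 := by
    rw [hG, ← Matrix.mul_assoc, Matrix.mul_nonsing_inv _ hNdet]
  have hCF : C₁ * F = 0 := by
    rw [hFdef, Matrix.mul_sub, ← Matrix.mul_assoc, hCG, Matrix.one_mul, sub_self]
  set B := G - B₁ * R⁻¹ with hB
  have hBR : B * R = G * R - B₁ := by
    rw [hB, Matrix.sub_mul, Matrix.nonsing_inv_mul_cancel_right _ _ hRdet]
  have unconj {l : Type} (M : Matrix (Fin n₁ ⊕ Fin n₂) l ℝ) : M = U * (Uᵀ * M) := by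
    rw [← Matrix.mul_assoc, hUU, Matrix.one_mul]
  have hFU : F = U * fromBlocks A₁₁ A₁₂ 0 A₂₂ * Uᵀ := by
    rw [← hAf, ← Matrix.mul_assoc, ← Matrix.mul_assoc, hUU, Matrix.one_mul, Matrix.mul_assoc,
      hUU, Matrix.mul_one]
  have hBU : B = U * fromRows Bf1 Bf2 := by rw [← hBf, ← unconj]
  have hB₁U : B₁ = U * fromRows B₁₁ B₂₂ := by rw [← hB1, ← unconj]
  have hblock : (fromBlocks 0 0 0 (T - S)⁻¹ * fromBlocks A₁₁ A₁₂ 0 A₂₂ +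
      (fromBlocks A₁₁ A₁₂ 0 A₂₂)ᵀ * fromBlocks 0 0 0 (T - S)⁻¹ :
        Matrix (Fin n₁ ⊕ Fin n₂) (Fin n₁ ⊕ Fin n₂) ℝ) =
      fromBlocks 0 0 0 (T - S)⁻¹ * (fromRows Bf1 Bf2 * R * (fromRows Bf1 Bf2)ᵀ -
        fromRows B₁₁ B₂₂ * R⁻¹ * (fromRows B₁₁ B₂₂)ᵀ) * fromBlocks 0 0 0 (T - S)⁻¹ := by
    simp only [fromBlocks_transpose, fromBlocks_multiply, fromBlocks_add, transpose_fromRows,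
      fromRows_mul, mul_fromCols, fromCols_fromRows_eq_fromBlocks, sub_eq_add_neg,
      fromBlocks_neg, Matrix.mul_zero, Matrix.zero_mul, transpose_zero, add_zero, zero_add]
    simp only [← sub_eq_add_neg, hX]
  have hric : P * F + Fᵀ * P = P * (B * R * Bᵀ - B₁ * R⁻¹ * B₁ᵀ) * P := by
    have h := congrArg (fun M => U * M * Uᵀ) hblock
    have cancel {l : Type} (M : Matrix (Fin n₁ ⊕ Fin n₂) l ℝ) : Uᵀ * (U * M) = M := by
      rw [← Matrix.mul_assoc, hU, Matrix.one_mul]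
    rw [hFU, hBU, hB₁U, hP]
    simpa only [transpose_mul, transpose_transpose, Matrix.mul_add, Matrix.add_mul,
      Matrix.mul_sub, Matrix.sub_mul, Matrix.mul_assoc, cancel] using h
  have hAbar' : Abar = F - G * R * Bᵀ * P := by
    have hGt : (B₂ᵀ * C₁ᵀ)⁻¹ * (B₂ᵀ * P) = Gᵀ * P := by
      rw [hG, transpose_mul, transpose_nonsing_inv, transpose_mul, Matrix.mul_assoc]
    have hRB : R * Bᵀ = R * Gᵀ - B₁ᵀ := by
      have h := congrArg transpose hBR
      simpa only [transpose_mul, transpose_sub, hRt] using h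
    rw [hAbar, hK, ← Matrix.mul_assoc, ← hG, Matrix.mul_assoc R, hGt, hFdef,
      Matrix.mul_assoc G, hRB]
    simp only [Matrix.mul_sub, Matrix.sub_mul, Matrix.mul_assoc]
    abel
  exact closedLoop_riccati hRu hRt hPt hCF hCG hBR hric hAbar' hAbar₀
end

section
/- Let A_f = [[A₁₁, A₁₂],[0, A₂₂]] be a real block upper triangular matrix, and let B_f = [B_{f1}; B_{f2}] and B̃₁ = [B₁₁; B₂₂] be conformably partitioned real matrices. Let R be a real symmetric invertible matrix, and suppose T and S are real symmetric matrices satisfying −A₂₂T − TA₂₂ᵀ + B_{f2} R B_{f2}ᵀ = 0 and −A₂₂S − SA₂₂ᵀ + B₂₂ R⁻¹ B₂₂ᵀ = 0, with Δ := T − S invertible. Then the matrix P_f := [[0, 0],[0, Δ⁻¹]] satisfies the algebraic Riccati equation P_f A_f + A_fᵀ P_f − P_f B_f R B_fᵀ P_f + P_f B̃₁ R⁻¹ B̃₁ᵀ P_f = 0. -/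
open Matrix

/-- If `Q₁ - Q₂ = A * Δ + Δ * Aᵀ` with `Δ` invertible, then `Δ⁻¹` solves the Riccati equation with
quadratic terms given by `Q₁` and `Q₂`. -/
theorem riccati_inv_of_lyapunov_s6 {n α : Type*} [Fintype n] [DecidableEq n] [CommRing α]
    {A Δ Q₁ Q₂ : Matrix n n α} (hΔ : IsUnit Δ) (h : Q₁ - Q₂ = A * Δ + Δ * Aᵀ) :
    Δ⁻¹ * A + Aᵀ * Δ⁻¹ - Δ⁻¹ * Q₁ * Δ⁻¹ + Δ⁻¹ * Q₂ * Δ⁻¹ = 0 := by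
  have hdet : IsUnit Δ.det := (Matrix.isUnit_iff_isUnit_det Δ).mp hΔ
  have hquad : Δ⁻¹ * Q₁ * Δ⁻¹ - Δ⁻¹ * Q₂ * Δ⁻¹ = Δ⁻¹ * A + Aᵀ * Δ⁻¹ := by
    rw [← Matrix.sub_mul, ← Matrix.mul_sub, h, Matrix.mul_add, Matrix.add_mul, ← Matrix.mul_assoc,
      Matrix.mul_nonsing_inv_cancel_right _ _ hdet, Matrix.nonsing_inv_mul_cancel_left _ _ hdet]
  rw [← hquad]
  abel

/-- A quadratic term compressed by `diag(0, D)` only involves the second block row. -/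
theorem fromBlocks_mul_fromRows_quadratic {n₁ n₂ m α : Type*} [Fintype n₁] [Fintype n₂]
    [Fintype m] [CommRing α] (D : Matrix n₂ n₂ α) (X₁ : Matrix n₁ m α) (X₂ : Matrix n₂ m α)
    (R : Matrix m m α) :
    (fromBlocks 0 0 0 D : Matrix (n₁ ⊕ n₂) (n₁ ⊕ n₂) α) * fromRows X₁ X₂ * R *
        (fromRows X₁ X₂)ᵀ * (fromBlocks 0 0 0 D : Matrix (n₁ ⊕ n₂) (n₁ ⊕ n₂) α) =
      fromBlocks 0 0 0 (D * (X₂ * R * X₂ᵀ) * D) := by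
  simp [fromBlocks_mul_fromRows, fromRows_mul, transpose_fromRows,
    fromBlocks_multiply, Matrix.mul_assoc]

/-- If `T` and `S` are symmetric solutions of the two Lyapunov equations associated with the
anti-stable block `A₂₂`, and `Δ = T - S` is invertible, then `P_f = diag(0, Δ⁻¹)` solves the
algebraic Riccati equation `P_f A_f + A_fᵀ P_f - P_f B_f R B_fᵀ P_f + P_f B̃₁ R⁻¹ B̃₁ᵀ P_f = 0`. -/
theorem stmt_6 {n₁ n₂ m : ℕ}
    (A₁₁ : Matrix (Fin n₁) (Fin n₁) ℝ) (A₁₂ : Matrix (Fin n₁) (Fin n₂) ℝ)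
    (A₂₂ : Matrix (Fin n₂) (Fin n₂) ℝ)
    (Bf1 : Matrix (Fin n₁) (Fin m) ℝ) (Bf2 : Matrix (Fin n₂) (Fin m) ℝ)
    (B₁₁ : Matrix (Fin n₁) (Fin m) ℝ) (B₂₂ : Matrix (Fin n₂) (Fin m) ℝ)
    (R : Matrix (Fin m) (Fin m) ℝ) (hRsymm : R = Rᵀ) (hRinv : IsUnit R)
    (T S : Matrix (Fin n₂) (Fin n₂) ℝ) (hTsymm : T = Tᵀ) (hSsymm : S = Sᵀ)
    (hLyapT : -(A₂₂ * T) - T * A₂₂ᵀ + Bf2 * R * Bf2ᵀ = 0)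
    (hLyapS : -(A₂₂ * S) - S * A₂₂ᵀ + B₂₂ * R⁻¹ * B₂₂ᵀ = 0)
    (hΔ : IsUnit (T - S))
    (Af : Matrix (Fin n₁ ⊕ Fin n₂) (Fin n₁ ⊕ Fin n₂) ℝ)
    (hAf : Af = Matrix.fromBlocks A₁₁ A₁₂ 0 A₂₂)
    (Bf B₁tilde : Matrix (Fin n₁ ⊕ Fin n₂) (Fin m) ℝ)
    (hBf : Bf = Matrix.fromRows Bf1 Bf2)
    (hB₁tilde : B₁tilde = Matrix.fromRows B₁₁ B₂₂)
    (Pf : Matrix (Fin n₁ ⊕ Fin n₂) (Fin n₁ ⊕ Fin n₂) ℝ)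
    (hPf : Pf = Matrix.fromBlocks 0 0 0 (T - S)⁻¹) :
    Pf * Af + Afᵀ * Pf - Pf * Bf * R * Bfᵀ * Pf + Pf * B₁tilde * R⁻¹ * B₁tildeᵀ * Pf = 0 := by
  have hdiff : Bf2 * R * Bf2ᵀ - B₂₂ * R⁻¹ * B₂₂ᵀ = A₂₂ * (T - S) + (T - S) * A₂₂ᵀ := by
    rw [Matrix.mul_sub, Matrix.sub_mul, ← sub_eq_zero, ← sub_eq_zero.mpr (hLyapT.trans hLyapS.symm)]
    abel
  subst hAf hBf hB₁tilde hPf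
  rw [fromBlocks_mul_fromRows_quadratic, fromBlocks_mul_fromRows_quadratic]
  simp only [sub_eq_add_neg, fromBlocks_transpose, fromBlocks_multiply, fromBlocks_neg,
    fromBlocks_add, Matrix.zero_mul, Matrix.mul_zero, transpose_zero, add_zero, zero_add, neg_zero]
  simp only [← sub_eq_add_neg]
  rw [riccati_inv_of_lyapunov_s6 hΔ hdiff, fromBlocks_zero]
end
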